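/- Let A₀ be a commutative ring, A a Noetherian commutative A₀-algebra, and I ⊆ A an ideal such that the composite A₀ → A → A/I is a ring isomorphism. Let Â denote the I-adic completion of A and let Î = I·Â. If φ : Â → Â is an A₀-algebra homomorphism satisfying φ(Î) ⊆ Î and such that the induced map Â/Î² → Â/Î² is an isomorphism, then φ is an isomorphism. -/

import Mathlib

theorem ringEnd_injective_of_surjective {R : Type*} [CommRing R] [IsNoetherianRing R]
    (f : R →+* R) (hf : Function.Surjective f) : Function.Injective f := by
  have hs : ∀ n : ℕ, Function.Surjective (f ^ n : R →+* R) := by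
    intro n
    rw [RingHom.coe_pow]
    exact hf.iterate n
  let F : ℕ →o Ideal R :=
    { toFun := fun n => RingHom.ker (f ^ n : R →+* R)
      monotone' := by
        apply monotone_nat_of_le_succ
        intro n x hx
        rw [RingHom.mem_ker] at hx ⊢
        rw [pow_succ', RingHom.mul_def, RingHom.comp_apply, hx, map_zero] }
  obtain ⟨n, hn⟩ := monotone_stabilizes_iff_noetherian.mpr ‹_› F
  rw [injective_iff_map_eq_zero]
  intro x hx
  obtain ⟨y, rfl⟩ := hs n x
  have h1 : y ∈ F (n + 1) := by
    change y ∈ RingHom.ker (f ^ (n + 1) : R →+* R)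
    rw [RingHom.mem_ker, pow_succ', RingHom.mul_def, RingHom.comp_apply, hx]
  rw [← hn (n + 1) (Nat.le_succ n)] at h1
  exact h1

theorem bijective_of_complete {R : Type*} [CommRing R] (J : Ideal R) (hfg : J.FG)
    [IsAdicComplete J R] (hN : ∀ n, IsNoetherianRing (R ⧸ J ^ n))
    (φ : R →+* R) (hJ : J.map φ ≤ J) (hid : ∀ x, φ x - x ∈ J)
    (h2 : ∀ y, ∃ x, φ x - y ∈ J ^ 2) : Function.Bijective φ := by
  have hle : J ≤ J.map φ := by
    apply Submodule.le_of_le_smul_of_le_jacobson_bot hfg (IsAdicComplete.le_jacobson_bot J)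
    intro y hy
    obtain ⟨x, hx⟩ := h2 y
    have hx1 : φ x - y ∈ J := Ideal.pow_le_self two_ne_zero hx
    have hxJ : x ∈ J := by
      have := J.sub_mem (J.add_mem hx1 hy) (hid x)
      simpa using this
    have : y = φ x + (-(φ x - y)) := by ring
    rw [this]
    refine Submodule.add_mem_sup (Ideal.mem_map_of_mem φ hxJ) ?_
    rw [smul_eq_mul, ← pow_two]
    exact neg_mem hx
  have heq : J.map φ = J := le_antisymm hJ hle
  have hsurj : Function.Surjective φ := by
    haveI : IsHausdorff (J.map φ) R := by rw [heq]; infer_instance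
    apply surjective_of_mk_map_comp_surjective (I := J)
    intro y
    obtain ⟨y, rfl⟩ := Ideal.Quotient.mk_surjective y
    refine ⟨y, ?_⟩
    rw [RingHom.comp_apply, Ideal.Quotient.mk_eq_mk_iff_sub_mem, heq]
    exact hid y
  refine ⟨?_, hsurj⟩
  rw [injective_iff_map_eq_zero]
  intro x hx
  apply IsHausdorff.haus (I := J) inferInstance x
  intro n
  have hn : J ^ n ≤ (J ^ n).comap φ := by
    rw [← Ideal.map_le_iff_le_comap, Ideal.map_pow, heq]
  haveI := hN n
  have hinj := ringEnd_injective_of_surjective (Ideal.quotientMap (J ^ n) φ hn)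
    (Ideal.quotientMap_surjective hsurj)
  rw [SModEq.zero, smul_eq_mul, Ideal.mul_top, ← Ideal.Quotient.eq_zero_iff_mem]
  apply hinj
  rw [Ideal.quotientMap_mk, hx, map_zero, map_zero]

theorem noeth_quot {A : Type*} [CommRing A] [IsNoetherianRing A] (I : Ideal A) (n : ℕ) :
    IsNoetherianRing (AdicCompletion I A ⧸
      (Ideal.map (algebraMap A (AdicCompletion I A)) I) ^ n) := by
  apply isNoetherianRing_of_surjective A _
    ((Ideal.Quotient.mk _).comp (algebraMap A (AdicCompletion I A)))
  intro y
  obtain ⟨y, rfl⟩ := Ideal.Quotient.mk_surjective y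
  obtain ⟨a, ha⟩ := Submodule.Quotient.mk_surjective _ (AdicCompletion.eval I A n y)
  refine ⟨a, ?_⟩
  rw [RingHom.comp_apply, Ideal.Quotient.mk_eq_mk_iff_sub_mem, ← Ideal.map_pow]
  have h : algebraMap A (AdicCompletion I A) a - y ∈ (AdicCompletion.eval I A n).ker := by
    rw [LinearMap.mem_ker, map_sub, ← ha, sub_eq_zero]
    rfl
  rw [← AdicCompletion.pow_smul_top_eq_ker_eval (IsNoetherian.noetherian I),
    Ideal.smul_top_eq_map] at h
  exact h

/-- **Lemma (lemma-completed-iso).** Let `A₀` be a commutative ring, `A` a Noetherian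
commutative `A₀`-algebra, and `I ⊆ A` an ideal such that the composite `A₀ → A → A/I` is
a ring isomorphism.  Let `Â` be the `I`-adic completion of `A` and `Î = I·Â` the ideal of
`Â` generated by the image of `I`.  If `φ : Â → Â` is an `A₀`-algebra homomorphism with
`φ(Î) ⊆ Î` inducing an isomorphism `Â/Î² → Â/Î²`, then `φ` is an isomorphism. -/
theorem bijective_of_bijective_mod_sq {A₀ A : Type*} [CommRing A₀] [CommRing A]
    [Algebra A₀ A] [IsNoetherianRing A] (I : Ideal A)
    (hiso : Function.Bijective ((Ideal.Quotient.mk I).comp (algebraMap A₀ A)))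
    (φ : AdicCompletion I A →+* AdicCompletion I A)
    (hφ : ∀ a : A₀,
      φ (algebraMap A (AdicCompletion I A) (algebraMap A₀ A a)) =
        algebraMap A (AdicCompletion I A) (algebraMap A₀ A a))
    (hI : Ideal.map φ (Ideal.map (algebraMap A (AdicCompletion I A)) I) ≤
      Ideal.map (algebraMap A (AdicCompletion I A)) I)
    (h2 : Function.Bijective
      (Ideal.quotientMap ((Ideal.map (algebraMap A (AdicCompletion I A)) I) ^ 2) φ
        (Ideal.map_le_iff_le_comap.mp (by
          rw [Ideal.map_pow]; exact Ideal.pow_right_mono hI 2)))) :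
    Function.Bijective φ := by
  have hfg : I.FG := IsNoetherian.noetherian I
  haveI := AdicCompletion.isAdicComplete_self I hfg
  refine bijective_of_complete (Ideal.map (algebraMap A (AdicCompletion I A)) I) (hfg.map _)
    (noeth_quot I) φ hI ?_ ?_
  · intro x
    obtain ⟨a, ha⟩ := hiso.2 (AdicCompletion.evalOneₐ I x)
    have hx : x - algebraMap A (AdicCompletion I A) (algebraMap A₀ A a) ∈
        Ideal.map (algebraMap A (AdicCompletion I A)) I := by
      rw [← AdicCompletion.ker_evalOneₐ_eq_map I hfg, RingHom.mem_ker, map_sub, sub_eq_zero]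
      exact ha.symm
    have h := Ideal.sub_mem _ (hI (Ideal.mem_map_of_mem φ hx)) hx
    rw [map_sub, hφ] at h
    simpa using h
  · intro y
    obtain ⟨x, hx⟩ := h2.2 (Ideal.Quotient.mk _ y)
    obtain ⟨x, rfl⟩ := Ideal.Quotient.mk_surjective x
    rw [Ideal.quotientMap_mk, Ideal.Quotient.mk_eq_mk_iff_sub_mem] at hx
    exact ⟨x, hx⟩
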